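/- arXiv:1705.04954 — 2 statements merged into one kernel-verified Lean document; each statement's English description precedes it below -/
import Mathlib

section
/- Let G be a finite connected simple graph that is claw-free and P_6-free (contains no induced subgraph isomorphic to the star K_{1,3} nor to the path on 6 vertices). Then for every finite simple graph H, γ(G □ H) ≥ γ(G)·γ(H). -/
open SimpleGraph Finset

/-- `S` is a dominating set of `G`: every vertex is in `S` or adjacent to a vertex of `S`. -/
def IsDomSet {V : Type*} (G : SimpleGraph V) (S : Finset V) : Prop :=
  ∀ v : V, v ∈ S ∨ ∃ u ∈ S, G.Adj u v

/-- The domination number of a finite graph. -/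
noncomputable def domNum {V : Type*} [Fintype V] (G : SimpleGraph V) : ℕ :=
  sInf {n | ∃ S : Finset V, S.card = n ∧ IsDomSet G S}

/-- `G` is `H`-free: `G` has no induced subgraph isomorphic to `H`,
equivalently there is no graph embedding of `H` into `G`. -/
def IsFree {V W : Type*} (G : SimpleGraph V) (H : SimpleGraph W) : Prop :=
  ¬ Nonempty (H ↪g G)

/-- Adjacent or equal. -/
def ClosedAdj {V : Type*} (G : SimpleGraph V) (u v : V) : Prop := u = v ∨ G.Adj u v

lemma ClosedAdj.symm {V : Type*} {G : SimpleGraph V} {u v : V} (h : ClosedAdj G u v) :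
    ClosedAdj G v u := h.imp Eq.symm SimpleGraph.Adj.symm

lemma ClosedAdj.rfl {V : Type*} {G : SimpleGraph V} {u : V} : ClosedAdj G u u := Or.inl _root_.rfl

lemma isDomSet_iff {V : Type*} {G : SimpleGraph V} {S : Finset V} :
    IsDomSet G S ↔ ∀ v, ∃ s ∈ S, ClosedAdj G s v := by
  refine forall_congr' fun v => ⟨?_, ?_⟩
  · rintro (h | ⟨u, hu, h⟩)
    exacts [⟨v, h, .inl rfl⟩, ⟨u, hu, .inr h⟩]
  · rintro ⟨s, hs, rfl | h⟩
    exacts [.inl hs, .inr ⟨s, hs, h⟩]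

lemma domNum_le {V : Type*} [Fintype V] {G : SimpleGraph V} {S : Finset V} (h : IsDomSet G S) :
    domNum G ≤ S.card := Nat.sInf_le ⟨S, rfl, h⟩

lemma exists_card_eq_domNum {V : Type*} [Fintype V] (G : SimpleGraph V) :
    ∃ S : Finset V, S.card = domNum G ∧ IsDomSet G S :=
  Nat.sInf_mem (s := {n | ∃ S : Finset V, S.card = n ∧ IsDomSet G S})
    ⟨_, Finset.univ, rfl, fun v => .inl (Finset.mem_univ v)⟩

section Rows

variable {V W : Type*} [Fintype V] {G : SimpleGraph V} {H : SimpleGraph W}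

open Classical in
/-- The row of `D ⊆ V × W` above `h`. -/
noncomputable def row (D : Finset (V × W)) (h : W) : Finset V :=
  Finset.univ.filter fun g => (g, h) ∈ D

lemma mem_row {D : Finset (V × W)} {h : W} {g : V} : g ∈ row D h ↔ (g, h) ∈ D := by
  simp [row]

lemma sum_card_row [Fintype W] (D : Finset (V × W)) : ∑ h, (row D h).card = D.card := by
  classical
  rw [Finset.card_eq_sum_card_fiberwise (f := Prod.snd) (t := Finset.univ) (by simp)]
  refine Finset.sum_congr rfl fun h _ => ?_
  refine Finset.card_bij (fun g _ => (g, h)) ?_ ?_ ?_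
  · intro g hg; simpa [mem_row] using hg
  · intro g _ g' _ hgg; simpa using hgg
  · rintro ⟨g, h'⟩ hg
    simp only [Finset.mem_filter] at hg
    obtain ⟨hg, rfl⟩ := hg
    exact ⟨g, mem_row.2 hg, rfl⟩

lemma IsDomSet.row_or {D : Finset (V × W)} (hD : IsDomSet (G □ H) D) (g : V) (h : W) :
    (∃ t ∈ row D h, ClosedAdj G g t) ∨ ∃ h', H.Adj h h' ∧ g ∈ row D h' := by
  rcases hD (g, h) with hg | ⟨⟨g', h'⟩, hg, hadj⟩
  · exact .inl ⟨g, mem_row.2 hg, .rfl⟩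
  · rw [SimpleGraph.boxProd_adj] at hadj
    rcases hadj with ⟨ha, rfl⟩ | ⟨ha, rfl⟩
    · exact .inl ⟨g', mem_row.2 hg, .inr ha.symm⟩
    · exact .inr ⟨h', ha.symm, mem_row.2 hg⟩

/-- A labelling of the rows of `D` with at most as many labels per row as the row has elements,
such that every label class dominates `H`. -/
lemma mul_domNum_le_of_labelling [Fintype W] {n : ℕ} {D : Finset (V × W)} (f : W → Finset (Fin n))
    (hf : ∀ h, (f h).card ≤ (row D h).card)
    (hdom : ∀ i h, ∃ h', ClosedAdj H h' h ∧ i ∈ f h') : n * domNum H ≤ D.card := by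
  classical
  calc n * domNum H = ∑ _i : Fin n, domNum H := by simp
    _ ≤ ∑ i : Fin n, (Finset.univ.filter fun h => i ∈ f h).card := by
        refine Finset.sum_le_sum fun i _ => domNum_le (isDomSet_iff.2 fun h => ?_)
        obtain ⟨h', hh, hi⟩ := hdom i h
        exact ⟨h', by simpa using hi, hh⟩
    _ = ∑ h, (f h).card := by
        have := Finset.sum_card_bipartiteAbove_eq_sum_card_bipartiteBelow
          (s := (Finset.univ : Finset (Fin n))) (t := (Finset.univ : Finset W))
          (fun i h => i ∈ f h)
        simpa [Finset.bipartiteAbove, Finset.bipartiteBelow] using this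
    _ ≤ ∑ h, (row D h).card := Finset.sum_le_sum fun h _ => hf h
    _ = D.card := sum_card_row D

/-- Vertices with pairwise disjoint closed neighbourhoods. -/
def IsPacking (G : SimpleGraph V) (S : Finset V) : Prop :=
  ∀ p ∈ S, ∀ q ∈ S, ∀ w, ClosedAdj G p w → ClosedAdj G w q → p = q

lemma IsPacking.card_mul_domNum_le [Fintype W] {S : Finset V} (hS : IsPacking G S)
    (H : SimpleGraph W) :
    S.card * domNum H ≤ domNum (G □ H) := by
  classical
  obtain ⟨D, hDc, hD⟩ := exists_card_eq_domNum (G □ H)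
  rw [← hDc]
  let e := S.equivFin
  refine mul_domNum_le_of_labelling
    (fun h => Finset.univ.filter fun i => ∃ t ∈ row D h, ClosedAdj G (e.symm i : V) t) ?_ ?_
  · intro h
    have : ∀ i : Fin S.card, ∃ t, (∃ t ∈ row D h, ClosedAdj G (e.symm i : V) t) →
        t ∈ row D h ∧ ClosedAdj G (e.symm i : V) t := by
      intro i
      by_cases hi : ∃ t ∈ row D h, ClosedAdj G (e.symm i : V) t
      · obtain ⟨t, ht⟩ := hi
        exact ⟨t, fun _ => ht⟩
      · exact ⟨e.symm i, fun h => absurd h hi⟩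
    choose t ht using this
    refine Finset.card_le_card_of_injOn t (fun i hi => (ht i (by simpa using hi)).1) ?_
    intro i hi j hj hij
    have hi := (ht i (by simpa using hi)).2
    have hj := (ht j (by simpa using hj)).2
    rw [← hij] at hj
    exact e.symm.injective (Subtype.ext (hS _ (e.symm i).2 _ (e.symm j).2 _ hi hj.symm))
  · intro i h
    rcases hD.row_or (e.symm i) h with ht | ⟨h', hh, ht⟩
    · exact ⟨h, .rfl, by simpa using ht⟩
    · exact ⟨h', .inr hh.symm, by simpa using ⟨_, ht, .rfl⟩⟩

end Rows

section IndependentDominating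

variable {V W : Type*} {G : SimpleGraph V} {n : ℕ}

open Classical in
/-- The labels `i` such that `v i` is dominated by `T`. -/
noncomputable def dominatedLabels (G : SimpleGraph V) (v : Fin n → V) (T : Finset V) :
    Finset (Fin n) := Finset.univ.filter fun i => ∃ t ∈ T, ClosedAdj G (v i) t

open Classical in
/-- The labels `i` such that `v i` belongs to `T`. -/
noncomputable def hitLabels (v : Fin n → V) (T : Finset V) : Finset (Fin n) :=
  Finset.univ.filter fun i => v i ∈ T

lemma mem_dominatedLabels {v : Fin n → V} {T : Finset V} {i : Fin n} :
    i ∈ dominatedLabels G v T ↔ ∃ t ∈ T, ClosedAdj G (v i) t := by simp [dominatedLabels]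

lemma mem_hitLabels {v : Fin n → V} {T : Finset V} {i : Fin n} :
    i ∈ hitLabels v T ↔ v i ∈ T := by simp [hitLabels]

lemma hitLabels_subset {v : Fin n → V} {T : Finset V} :
    hitLabels v T ⊆ dominatedLabels G v T := fun _ hi =>
  mem_dominatedLabels.2 ⟨_, mem_hitLabels.1 hi, .rfl⟩

lemma dominatedLabels_mono {v : Fin n → V} {S T : Finset V} (h : S ⊆ T) :
    dominatedLabels G v S ⊆ dominatedLabels G v T := fun _ hi => by
  obtain ⟨t, ht, hi⟩ := mem_dominatedLabels.1 hi
  exact mem_dominatedLabels.2 ⟨t, h ht, hi⟩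

/-- The labels that are dominated but not hit. -/
noncomputable def freeLabels (G : SimpleGraph V) (v : Fin n → V) (T : Finset V) :
    Finset (Fin n) := dominatedLabels G v T \ hitLabels v T

/-- More labels are dominated by `T` than `T` has elements. -/
def Deficient (G : SimpleGraph V) (v : Fin n → V) (T : Finset V) : Prop :=
  T.card < (dominatedLabels G v T).card

/-- `v` is an independent dominating family of minimum size, and no vertex is adjacent to three
of its members. -/
structure IsIndepDominating (G : SimpleGraph V) (v : Fin n → V) : Prop where
  indep : ∀ i j, ClosedAdj G (v i) (v j) → i = j
  dom : ∀ w, ∃ i, ClosedAdj G (v i) w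
  le_two : ∀ w i j k, ClosedAdj G (v i) w → ClosedAdj G (v j) w → ClosedAdj G (v k) w →
    i = j ∨ i = k ∨ j = k
  le_card : ∀ S, IsDomSet G S → n ≤ S.card

namespace IsIndepDominating

variable {v : Fin n → V} {S T : Finset V}

lemma injective (hv : IsIndepDominating G v) : Function.Injective v :=
  fun i j h => hv.indep i j (.inl h)

lemma card_hitLabels_le (hv : IsIndepDominating G v) : (hitLabels v T).card ≤ T.card :=
  Finset.card_le_card_of_injOn v (fun _ hi => mem_hitLabels.1 hi) hv.injective.injOn

lemma card_dominatedLabels_singleton_le (hv : IsIndepDominating G v) (w : V) :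
    (dominatedLabels G v {w}).card ≤ 2 := by
  by_contra! h
  obtain ⟨i, j, k, hi, hj, hk, hij, hik, hjk⟩ := Finset.two_lt_card_iff.1 h
  simp only [mem_dominatedLabels, Finset.mem_singleton, exists_eq_left] at hi hj hk
  rcases hv.le_two w i j k hi hj hk with h | h | h
  exacts [hij h, hik h, hjk h]

lemma card_dominatedLabels_le (hv : IsIndepDominating G v) (hn : n ≤ 3) :
    (dominatedLabels G v T).card ≤ T.card + 1 := by
  have h3 : (dominatedLabels G v T).card ≤ 3 :=
    (Finset.card_le_univ _).trans (by simpa using hn)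
  rcases T.card.lt_or_ge 2 with h | h
  · rcases T.eq_empty_or_nonempty with rfl | hT
    · simp [dominatedLabels]
    · obtain ⟨w, rfl⟩ := Finset.card_eq_one.1
        (le_antisymm (Nat.lt_succ_iff.1 h) hT.card_pos)
      simpa using hv.card_dominatedLabels_singleton_le w
  · omega

lemma two_le_card_freeLabels (hv : IsIndepDominating G v) (hT : Deficient G v T) :
    2 ≤ (freeLabels G v T).card := by
  classical
  have hF := hv.card_hitLabels_le (T := T)
  have hlt : (hitLabels v T).card < T.card := by
    refine lt_of_le_of_ne hF fun h => ?_
    have himg : (hitLabels v T).image v = T := by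
      refine Finset.eq_of_subset_of_card_le ?_ ?_
      · intro t ht
        obtain ⟨i, hi, rfl⟩ := Finset.mem_image.1 ht
        exact mem_hitLabels.1 hi
      · rw [Finset.card_image_of_injective _ hv.injective, h]
    have : dominatedLabels G v T ⊆ hitLabels v T := by
      intro i hi
      obtain ⟨t, ht, hit⟩ := mem_dominatedLabels.1 hi
      rw [← himg] at ht
      obtain ⟨j, hj, rfl⟩ := Finset.mem_image.1 ht
      rwa [hv.indep i j hit]
    have := Finset.card_le_card this
    unfold Deficient at hT
    omega
  unfold Deficient at hT
  rw [freeLabels, Finset.card_sdiff_of_subset hitLabels_subset]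
  omega

/-- A deficient set leaves a vertex undominated all of whose labels are free. -/
lemma exists_undominated (hv : IsIndepDominating G v) (hT : Deficient G v T) :
    ∃ w, (∀ t ∈ T, ¬ ClosedAdj G w t) ∧ (dominatedLabels G v {w}).Nonempty ∧
      dominatedLabels G v {w} ⊆ freeLabels G v T := by
  classical
  have : ¬ IsDomSet G (T ∪ (dominatedLabels G v T)ᶜ.image v) := by
    intro h
    have h1 := hv.le_card _ h
    have h2 := Finset.card_union_le T ((dominatedLabels G v T)ᶜ.image v)
    have h3 : ((dominatedLabels G v T)ᶜ.image v).card ≤ (dominatedLabels G v T)ᶜ.card :=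
      Finset.card_image_le
    have h4 := Finset.card_add_card_compl (dominatedLabels G v T)
    rw [Fintype.card_fin] at h4
    unfold Deficient at hT
    omega
  rw [isDomSet_iff] at this
  push Not at this
  obtain ⟨w, hw⟩ := this
  refine ⟨w, fun t ht h => hw t (Finset.mem_union_left _ ht) h.symm, ?_, ?_⟩
  · obtain ⟨i, hi⟩ := hv.dom w
    exact ⟨i, mem_dominatedLabels.2 ⟨w, by simp, hi⟩⟩
  · intro i hi
    simp only [mem_dominatedLabels, Finset.mem_singleton, exists_eq_left] at hi
    simp only [freeLabels, Finset.mem_sdiff]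
    constructor
    · by_contra h
      exact hw (v i) (Finset.mem_union_right _
        (Finset.mem_image_of_mem _ (Finset.mem_compl.2 h))) hi
    · intro h
      exact hw (v i) (Finset.mem_union_left _ (mem_hitLabels.1 h)) hi

lemma two_le_card_freeLabels_inter (hv : IsIndepDominating G v) (hn : n ≤ 3)
    (hT : Deficient G v T) (hS : Deficient G v S)
    {w : V} (hw : w ∈ S) (hwT : dominatedLabels G v {w} ⊆ freeLabels G v T) :
    2 ≤ (freeLabels G v T ∩ dominatedLabels G v S).card := by
  have h2 := hv.two_le_card_freeLabels hT
  unfold Deficient at hS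
  rcases S.card.lt_or_ge 2 with h | h
  · obtain ⟨x, rfl⟩ := Finset.card_eq_one.1
      (le_antisymm (Nat.lt_succ_iff.1 h) (Finset.card_pos.2 ⟨w, hw⟩))
    obtain rfl := Finset.mem_singleton.1 hw
    rw [Finset.inter_eq_right.2 hwT]
    simpa [Nat.succ_le_iff] using hS
  · have : dominatedLabels G v S = Finset.univ := by
      refine Finset.eq_univ_of_card _ (le_antisymm (Finset.card_le_univ _) ?_)
      rw [Fintype.card_fin]
      omega
    simpa [this] using h2

lemma freeLabels_inter_nonempty (hv : IsIndepDominating G v) (hn : n ≤ 3)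
    (hT : Deficient G v T) (hS : Deficient G v S)
    (hne : T.Nonempty) : (freeLabels G v S ∩ dominatedLabels G v T).Nonempty := by
  classical
  have h1 := hv.two_le_card_freeLabels hS
  have h2 := hne.card_pos
  unfold Deficient at hT
  have h3 := Finset.card_union_add_card_inter (freeLabels G v S) (dominatedLabels G v T)
  have h4 := Finset.card_le_univ (freeLabels G v S ∪ dominatedLabels G v T)
  rw [Fintype.card_fin] at h4
  rw [← Finset.card_pos]
  omega

end IsIndepDominating

/-- In a finite graph on which every deficient vertex `h` has a neighbour offering a label among
those it needs, and any two neighbouring deficient vertices can serve each other, the omitted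
labels can be chosen consistently. -/
lemma exists_consistent_labels [Finite W] {H : SimpleGraph W} (Def : W → Prop)
    (C L : W → Finset (Fin n))
    (hpart : ∀ h, Def h → ∃ h', H.Adj h h' ∧ (C h ∩ L h').Nonempty ∧
      (Def h' → 2 ≤ (C h ∩ L h').card ∧ (C h' ∩ L h).Nonempty)) :
    ∃ c : W → Option (Fin n), ∀ h, Def h → ∃ i ∈ C h, c h = some i ∧
      ∃ h', H.Adj h h' ∧ i ∈ L h' ∧ (Def h' → c h' ≠ some i) := by
  classical
  have := Fintype.ofFinite W
  let Good (K : Finset W) : Prop := (∀ h ∈ K, Def h) ∧ ∃ c : W → Option (Fin n),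
    ∀ h ∈ K, ∃ i ∈ C h, c h = some i ∧
      ∃ h', H.Adj h h' ∧ i ∈ L h' ∧ (Def h' → h' ∈ K ∧ c h' ≠ some i)
  obtain ⟨K, hKgood, hKmax⟩ := (Finset.univ.filter Good).exists_maximal
    ⟨∅, by simp [Good]⟩
  simp only [Finset.mem_filter, Finset.mem_univ, true_and] at hKgood hKmax
  obtain ⟨hKD, c, hc⟩ := hKgood
  have hall : ∀ h, Def h → h ∈ K := by
    intro h hD
    by_contra hK
    obtain ⟨h', hadj, hne, hdef⟩ := hpart h hD
    by_cases hext : Def h' → h' ∈ K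
    · have : ∃ i ∈ C h, i ∈ L h' ∧ (Def h' → c h' ≠ some i) := by
        by_cases hD' : Def h'
        · obtain ⟨i, hi, j, hj, hij⟩ := Finset.one_lt_card.1 (hdef hD').1
          simp only [Finset.mem_inter] at hi hj
          by_cases hci : c h' = some i
          · exact ⟨j, hj.1, hj.2, fun _ h => hij (Option.some.inj (hci.symm.trans h))⟩
          · exact ⟨i, hi.1, hi.2, fun _ => hci⟩
        · obtain ⟨i, hi⟩ := hne
          simp only [Finset.mem_inter] at hi
          exact ⟨i, hi.1, hi.2, fun h => absurd h hD'⟩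
      obtain ⟨i, hiC, hiL, hi⟩ := this
      have hgood : Good (insert h K) := by
        refine ⟨by simpa using ⟨hD, hKD⟩, Function.update c h (some i), ?_⟩
        intro g hg
        rcases Finset.mem_insert.1 hg with rfl | hgK
        · refine ⟨i, hiC, by simp, h', hadj, hiL, fun hD' => ⟨by simp [hext hD'], ?_⟩⟩
          rw [Function.update_of_ne hadj.ne']
          exact hi hD'
        · obtain ⟨j, hj, hcg, g', hg', hjL, hjd⟩ := hc g hgK
          have hgh : g ≠ h := fun e => hK (e ▸ hgK)
          refine ⟨j, hj, by rw [Function.update_of_ne hgh, hcg], g', hg', hjL, fun hD' => ?_⟩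
          have hgh' : g' ≠ h := by rintro rfl; exact hK (hjd hD').1
          rw [Function.update_of_ne hgh']
          exact ⟨by simp [(hjd hD').1], (hjd hD').2⟩
      exact hK (hKmax hgood (Finset.subset_insert _ _) (Finset.mem_insert_self _ _))
    · push Not at hext
      obtain ⟨hD', hK'⟩ := hext
      obtain ⟨h2, j, hj⟩ := hdef hD'
      obtain ⟨i, hi, hij⟩ := Finset.exists_mem_ne h2 j
      simp only [Finset.mem_inter] at hi hj
      have hgood : Good (insert h (insert h' K)) := by
        refine ⟨by simpa using ⟨hD, hD', hKD⟩,
          Function.update (Function.update c h' (some j)) h (some i), ?_⟩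
        intro g hg
        rw [Finset.mem_insert, Finset.mem_insert] at hg
        rcases hg with rfl | rfl | hg
        · refine ⟨i, hi.1, by simp, h', hadj, hi.2, fun _ => ⟨by simp, ?_⟩⟩
          simpa [Function.update_of_ne hadj.ne'] using hij.symm
        · refine ⟨j, hj.1, by simp [Function.update_of_ne hadj.ne'], h, hadj.symm, hj.2,
            fun _ => ⟨by simp, ?_⟩⟩
          simpa using hij
        · obtain ⟨k, hk, hcg, g', hg', hkL, hkd⟩ := hc g hg
          have hgh : g ≠ h := by rintro rfl; exact hK hg
          have hgh2 : g ≠ h' := by rintro rfl; exact hK' hg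
          refine ⟨k, hk, by rw [Function.update_of_ne hgh, Function.update_of_ne hgh2, hcg],
            g', hg', hkL, fun hD' => ?_⟩
          have hgh' : g' ≠ h := by rintro rfl; exact hK (hkd hD').1
          have hgh2' : g' ≠ h' := by rintro rfl; exact hK' (hkd hD').1
          rw [Function.update_of_ne hgh', Function.update_of_ne hgh2']
          exact ⟨by simp [(hkd hD').1], (hkd hD').2⟩
      exact hK (hKmax hgood (fun x hx => by simp [hx]) (Finset.mem_insert_self _ _))
  refine ⟨c, fun h hD => ?_⟩
  obtain ⟨i, hi, hci, h', hadj, hiL, hd⟩ := hc h (hall h hD)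
  exact ⟨i, hi, hci, h', hadj, hiL, fun hD' => (hd hD').2⟩

lemma IsIndepDominating.mul_domNum_le [Fintype V] [Fintype W] {v : Fin n → V}
    (hv : IsIndepDominating G v) (hn : n ≤ 3) (H : SimpleGraph W) :
    n * domNum H ≤ domNum (G □ H) := by
  classical
  obtain ⟨D, hDc, hD⟩ := exists_card_eq_domNum (G □ H)
  rw [← hDc]
  obtain ⟨c, hc⟩ := exists_consistent_labels (H := H) (fun h => Deficient G v (row D h))
    (fun h => freeLabels G v (row D h)) (fun h => dominatedLabels G v (row D h)) (by
      intro h hdef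
      obtain ⟨w, hw, hne, hsub⟩ := hv.exists_undominated hdef
      rcases hD.row_or w h with ⟨t, ht, hwt⟩ | ⟨h', hadj, hwh'⟩
      · exact absurd hwt (hw t ht)
      refine ⟨h', hadj, ?_, fun hdef' => ⟨?_, ?_⟩⟩
      · obtain ⟨i, hi⟩ := hne
        exact ⟨i, Finset.mem_inter.2 ⟨hsub hi,
          dominatedLabels_mono (Finset.singleton_subset_iff.2 hwh') hi⟩⟩
      · exact hv.two_le_card_freeLabels_inter hn hdef hdef' hwh' hsub
      · refine hv.freeLabels_inter_nonempty hn hdef hdef' ?_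
        rw [Finset.nonempty_iff_ne_empty]
        intro hrow
        simp [Deficient, hrow, dominatedLabels] at hdef)
  refine mul_domNum_le_of_labelling (fun h => (dominatedLabels G v (row D h)).filter fun i =>
    Deficient G v (row D h) → c h ≠ some i) ?_ ?_
  · intro h
    by_cases hdef : Deficient G v (row D h)
    · obtain ⟨i, hi, hci, -⟩ := hc h hdef
      have hi' := (Finset.mem_sdiff.1 hi).1
      have : (dominatedLabels G v (row D h)).filter
          (fun i => Deficient G v (row D h) → c h ≠ some i) ⊆
          (dominatedLabels G v (row D h)).erase i := by
        intro j hj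
        simp only [Finset.mem_filter, hdef, hci, forall_const] at hj
        exact Finset.mem_erase.2 ⟨fun h => hj.2 (by rw [h]), hj.1⟩
      refine (Finset.card_le_card this).trans ?_
      rw [Finset.card_erase_of_mem hi']
      have := hv.card_dominatedLabels_le (T := row D h) hn
      omega
    · exact (Finset.card_filter_le _ _).trans (not_lt.1 hdef)
  · intro i h
    by_cases hi : i ∈ dominatedLabels G v (row D h)
    · by_cases hom : Deficient G v (row D h) → c h ≠ some i
      · exact ⟨h, .rfl, Finset.mem_filter.2 ⟨hi, hom⟩⟩
      · push Not at hom
        obtain ⟨j, -, hcj, h', hadj, hj, hj'⟩ := hc h hom.1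
        obtain rfl : i = j := Option.some.inj (hom.2.symm.trans hcj)
        exact ⟨h', .inr hadj.symm, Finset.mem_filter.2 ⟨hj, hj'⟩⟩
    · rcases hD.row_or (v i) h with ht | ⟨h', hadj, hvi⟩
      · exact absurd (mem_dominatedLabels.2 ht) hi
      · have hF : i ∈ hitLabels v (row D h') := mem_hitLabels.2 hvi
        refine ⟨h', .inr hadj.symm, Finset.mem_filter.2 ⟨hitLabels_subset hF, ?_⟩⟩
        intro hdef hci
        obtain ⟨j, hj, hcj, -⟩ := hc h' hdef
        obtain rfl : i = j := Option.some.inj (hci.symm.trans hcj)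
        exact (Finset.mem_sdiff.1 hj).2 hF

end IndependentDominating

section Forbidden

variable {V : Type*} {G : SimpleGraph V}

/-- Claw-freeness in terms of closed adjacency. -/
lemma IsFree.claw (h : IsFree G (completeBipartiteGraph (Fin 1) (Fin 3))) {c x y z : V}
    (hx : ClosedAdj G c x) (hy : ClosedAdj G c y) (hz : ClosedAdj G c z) :
    ClosedAdj G x y ∨ ClosedAdj G x z ∨ ClosedAdj G y z := by
  by_contra! hn
  obtain ⟨hxy, hxz, hyz⟩ := hn
  have hx' : G.Adj c x := hx.resolve_left (by rintro rfl; exact hxy hy)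
  have hy' : G.Adj c y := hy.resolve_left (by rintro rfl; exact hxy hx.symm)
  have hz' : G.Adj c z := hz.resolve_left (by rintro rfl; exact hxz hx.symm)
  simp only [ClosedAdj, not_or] at hxy hxz hyz
  refine h ⟨⟨⟨Sum.elim (fun _ => c) ![x, y, z], ?_⟩, ?_⟩⟩
  · rintro (i | i) (j | j) hij
    · simp [Subsingleton.elim i j]
    · fin_cases j <;> simp [hx'.ne, hy'.ne, hz'.ne] at hij
    · fin_cases i <;> simp [hx'.ne', hy'.ne', hz'.ne'] at hij
    · fin_cases i <;> fin_cases j <;>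
        simp [hxy.1, hxz.1, hyz.1, Ne.symm hxy.1, Ne.symm hxz.1, Ne.symm hyz.1] at hij ⊢
  · intro i j
    change G.Adj (Sum.elim (fun _ => c) ![x, y, z] i) (Sum.elim (fun _ => c) ![x, y, z] j) ↔ _
    rcases i with i | i <;> rcases j with j | j
    · simp
    · fin_cases j <;> simp [hx', hy', hz']
    · fin_cases i <;> simp [hx'.symm, hy'.symm, hz'.symm]
    · fin_cases i <;> fin_cases j <;>
        simp [hxy.2, hxz.2, hyz.2, G.adj_comm y x, G.adj_comm z x, G.adj_comm z y]

/-- `P₆`-freeness in terms of closed adjacency. -/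
lemma IsFree.path_six (h : IsFree G (pathGraph 6)) {a b c d e f : V}
    (hab : ClosedAdj G a b) (hbc : ClosedAdj G b c) (hcd : ClosedAdj G c d)
    (hde : ClosedAdj G d e) (hef : ClosedAdj G e f) (hac : ¬ ClosedAdj G a c)
    (had : ¬ ClosedAdj G a d) (hae : ¬ ClosedAdj G a e) (haf : ¬ ClosedAdj G a f)
    (hbd : ¬ ClosedAdj G b d) (hbe : ¬ ClosedAdj G b e) (hbf : ¬ ClosedAdj G b f)
    (hce : ¬ ClosedAdj G c e) (hcf : ¬ ClosedAdj G c f) (hdf : ¬ ClosedAdj G d f) : False := by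
  have hab' : G.Adj a b := hab.resolve_left (by rintro rfl; exact hac hbc)
  have hbc' : G.Adj b c := hbc.resolve_left (by rintro rfl; exact hac hab)
  have hcd' : G.Adj c d := hcd.resolve_left (by rintro rfl; exact hbd hbc)
  have hde' : G.Adj d e := hde.resolve_left (by rintro rfl; exact hce hcd)
  have hef' : G.Adj e f := hef.resolve_left (by rintro rfl; exact hdf hde)
  simp only [ClosedAdj, not_or] at hac had hae haf hbd hbe hbf hce hcf hdf
  have yes : ∀ {x y : V} {p : Prop}, G.Adj x y → p → x ≠ y ∧ (G.Adj x y ↔ p) :=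
    fun hxy hp => ⟨hxy.ne, iff_of_true hxy hp⟩
  have no : ∀ {x y : V} {p : Prop}, ¬ x = y ∧ ¬ G.Adj x y → ¬ p → x ≠ y ∧ (G.Adj x y ↔ p) :=
    fun hxy hp => ⟨hxy.1, iff_of_false hxy.2 hp⟩
  have key : ∀ i j : Fin 6, i < j → ![a, b, c, d, e, f] i ≠ ![a, b, c, d, e, f] j ∧
      (G.Adj (![a, b, c, d, e, f] i) (![a, b, c, d, e, f] j) ↔ (pathGraph 6).Adj i j) := by
    intro i j hij
    simp only [pathGraph_adj]
    fin_cases i <;> fin_cases j <;> first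
      | exact absurd hij (by decide)
      | exact yes hab' (by decide)
      | exact yes hbc' (by decide)
      | exact yes hcd' (by decide)
      | exact yes hde' (by decide)
      | exact yes hef' (by decide)
      | exact no hac (by decide)
      | exact no had (by decide)
      | exact no hae (by decide)
      | exact no haf (by decide)
      | exact no hbd (by decide)
      | exact no hbe (by decide)
      | exact no hbf (by decide)
      | exact no hce (by decide)
      | exact no hcf (by decide)
      | exact no hdf (by decide)
  refine h ⟨⟨⟨![a, b, c, d, e, f], fun i j hij => ?_⟩, fun {i j} => ?_⟩⟩
  · rcases lt_trichotomy i j with hlt | heq | hlt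
    exacts [absurd hij (key i j hlt).1, heq, absurd hij.symm (key j i hlt).1]
  · change G.Adj (![a, b, c, d, e, f] i) (![a, b, c, d, e, f] j) ↔ _
    rcases lt_trichotomy i j with hlt | rfl | hlt
    · exact (key i j hlt).2
    · simp
    · rw [G.adj_comm, (pathGraph 6).adj_comm]
      exact (key j i hlt).2

/-- Every claw-free graph has an independent minimum dominating set. -/
lemma IsFree.exists_independent_isDomSet [Fintype V]
    (hclaw : IsFree G (completeBipartiteGraph (Fin 1) (Fin 3))) :
    ∃ S : Finset V, S.card = domNum G ∧ IsDomSet G S ∧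
      ∀ s ∈ S, ∀ t ∈ S, ClosedAdj G s t → s = t := by
  classical
  obtain ⟨S, hS, hmin⟩ := Finset.exists_min_image
    (Finset.univ.filter fun S : Finset V => S.card = domNum G ∧ IsDomSet G S)
    (fun S => ((S ×ˢ S).filter fun p => G.Adj p.1 p.2).card) (by
      obtain ⟨S, hS⟩ := exists_card_eq_domNum G
      exact ⟨S, by simpa using hS⟩)
  simp only [Finset.mem_filter, Finset.mem_univ, true_and] at hS hmin
  refine ⟨S, hS.1, hS.2, fun u hu v hv huv => ?_⟩
  by_contra hne
  have hadj : G.Adj u v := huv.resolve_left hne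
  have hnd : ¬ IsDomSet G (S.erase u) := fun h => by
    have := domNum_le h
    rw [Finset.card_erase_of_mem hu, hS.1] at this
    have := Finset.card_pos.2 ⟨u, hu⟩
    omega
  rw [isDomSet_iff] at hnd
  push Not at hnd
  obtain ⟨x, hx⟩ := hnd
  have hvS : v ∈ S.erase u := Finset.mem_erase.2 ⟨Ne.symm hne, hv⟩
  have key : ∀ y, (∀ s ∈ S.erase u, ¬ ClosedAdj G s y) → ClosedAdj G u y := by
    intro y hy
    obtain ⟨s, hs, hsy⟩ := isDomSet_iff.1 hS.2 y
    by_cases hsu : s = u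
    · exact hsu ▸ hsy
    · exact absurd hsy (hy s (Finset.mem_erase.2 ⟨hsu, hs⟩))
  have hxS : x ∉ S.erase u := fun h => hx x h .rfl
  have hcard : (insert x (S.erase u)).card = domNum G := by
    rw [Finset.card_insert_of_notMem hxS, Finset.card_erase_add_one hu, hS.1]
  have hdom : IsDomSet G (insert x (S.erase u)) := by
    rw [isDomSet_iff]
    intro y
    by_cases hy : ∀ s ∈ S.erase u, ¬ ClosedAdj G s y
    · refine ⟨x, Finset.mem_insert_self _ _, ?_⟩
      rcases hclaw.claw huv (key x hx) (key y hy) with h | h | h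
      exacts [absurd h (hx v hvS), absurd h (hy v hvS), h]
    · push Not at hy
      obtain ⟨s, hs, hsy⟩ := hy
      exact ⟨s, Finset.mem_insert_of_mem hs, hsy⟩
  refine absurd (hmin _ ⟨hcard, hdom⟩) (not_le.2 (Finset.card_lt_card ?_))
  refine Finset.ssubset_iff_subset_ne.2 ⟨?_, ?_⟩
  · rintro ⟨p, q⟩ hpq
    simp only [Finset.mem_filter, Finset.mem_product, Finset.mem_insert] at hpq ⊢
    obtain ⟨⟨hp, hq⟩, ha⟩ := hpq
    rcases hp with rfl | hp
    · rcases hq with rfl | hq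
      · exact absurd ha (G.irrefl)
      · exact absurd (.inr ha.symm) (hx q hq)
    · rcases hq with rfl | hq
      · exact absurd (.inr ha) (hx p hp)
      · exact ⟨⟨Finset.mem_of_mem_erase hp, Finset.mem_of_mem_erase hq⟩, ha⟩
  · intro heq
    have : (u, v) ∈ (S ×ˢ S).filter fun p => G.Adj p.1 p.2 := by simp [hu, hv, hadj]
    rw [← heq] at this
    simp only [Finset.mem_filter, Finset.mem_product, Finset.mem_insert, Finset.mem_erase] at this
    rcases this.1.1 with h | h
    · exact hx v hvS (h ▸ .inr hadj.symm)
    · exact h.1 rfl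

lemma IsFree.mul_domNum_le_of_domNum_le_three {W : Type*} [Fintype V] [Fintype W]
    (hclaw : IsFree G (completeBipartiteGraph (Fin 1) (Fin 3))) (h : domNum G ≤ 3)
    (H : SimpleGraph W) : domNum G * domNum H ≤ domNum (G □ H) := by
  obtain ⟨S, hSc, hSd, hSi⟩ := hclaw.exists_independent_isDomSet
  rw [← hSc] at h ⊢
  let e := S.equivFin
  have hi : ∀ i j, ClosedAdj G (e.symm i : V) (e.symm j) → i = j := fun i j hij =>
    e.symm.injective (Subtype.ext (hSi _ (e.symm i).2 _ (e.symm j).2 hij))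
  refine IsIndepDominating.mul_domNum_le (v := fun i => (e.symm i : V)) ⟨hi, ?_, ?_, ?_⟩ h H
  · intro w
    obtain ⟨s, hs, hsw⟩ := isDomSet_iff.1 hSd w
    exact ⟨e ⟨s, hs⟩, by simpa using hsw⟩
  · intro w i j k h1 h2 h3
    exact (hclaw.claw h1.symm h2.symm h3.symm).imp (hi _ _) (Or.imp (hi _ _) (hi _ _))
  · intro T hT
    rw [hSc]
    exact domNum_le hT

end Forbidden

universe u

section Structure

variable {V : Type*}

/-- A reflexive symmetric relation without induced claws and induced six-vertex paths. -/
structure IsClawPathFree (R : V → V → Prop) : Prop where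
  refl : ∀ a, R a a
  symm : ∀ {a b}, R a b → R b a
  claw : ∀ c x y z, R c x → R c y → R c z → R x y ∨ R x z ∨ R y z
  path : ∀ a b c d e f, R a b → R b c → R c d → R d e → R e f →
    R a c ∨ R a d ∨ R a e ∨ R a f ∨ R b d ∨ R b e ∨ R b f ∨ R c e ∨ R c f ∨ R d f

/-- A reflexive symmetric relation without induced claws, six-vertex paths and six-cycles. -/
structure IsClawPathCycleFree (R : V → V → Prop) : Prop extends IsClawPathFree R where
  cycle : ∀ a b c d e f, R a b → R b c → R c d → R d e → R e f → R f a →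
    R a c ∨ R a d ∨ R a e ∨ R b d ∨ R b e ∨ R b f ∨ R c e ∨ R c f ∨ R d f

/-- Every nonempty set of vertices closed under `R` contains all vertices. -/
def IsConn (R : V → V → Prop) : Prop :=
  ∀ P : V → Prop, (∃ v, P v) → (∀ v w, P v → R v w → P w) → ∀ v, P v

/-- There is a dominating set with at most three elements. -/
def HasSmallDom (R : V → V → Prop) : Prop := ∃ a b c, ∀ v, R a v ∨ R b v ∨ R c v

/-- There is a packing at least as large as some dominating set. -/
def HasTightPacking (R : V → V → Prop) : Prop :=
  ∃ S T : Finset V, (∀ p ∈ S, ∀ q ∈ S, ∀ w, R p w → R w q → p = q) ∧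
    (∀ v, ∃ t ∈ T, R t v) ∧ T.card ≤ S.card

lemma HasTightPacking.of_families {R : V → V → Prop} (hrefl : ∀ a, R a a) {κ κ' : Type*}
    [Fintype κ] [Fintype κ'] (p : κ → V) (t : κ' → V)
    (hp : ∀ i j w, R (p i) w → R w (p j) → i = j) (ht : ∀ v, ∃ i, R (t i) v)
    (hcard : Fintype.card κ' ≤ Fintype.card κ) : HasTightPacking R := by
  classical
  refine ⟨Finset.univ.image p, Finset.univ.image t, ?_, ?_, ?_⟩
  · simp only [Finset.mem_image, Finset.mem_univ, true_and]
    rintro _ ⟨i, rfl⟩ _ ⟨j, rfl⟩ w h1 h2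
    rw [hp i j w h1 h2]
  · intro v
    obtain ⟨i, hi⟩ := ht v
    exact ⟨t i, Finset.mem_image_of_mem _ (Finset.mem_univ i), hi⟩
  · have hinj : Function.Injective p := fun i j h => hp i j (p i) (hrefl _) (h ▸ hrefl _)
    rw [Finset.card_image_of_injective _ hinj]
    exact Finset.card_image_le.trans hcard

namespace IsClawPathFree

variable {R : V → V → Prop}

lemma dominated_of_neighbour (hR : IsClawPathFree R) {a b c d e f v w : V} (hbc : R b c)
    (hcd : R c d) (hde : R d e) (hac : ¬ R a c) (had : ¬ R a d) (hae : ¬ R a e)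
    (hbd : ¬ R b d) (hbe : ¬ R b e) (_ : ¬ R b f) (hce : ¬ R c e)
    (hva : R v a) (hvb : R v b) (hvw : R v w) :
    R w a ∨ R w b ∨ R w c ∨ R w d ∨ R w e ∨ R w f := by
  have hs := @hR.symm
  have h1 := hR.claw v w a c
  have h2 := hR.claw v w a d
  have h3 := hR.claw v w a e
  have h4 := hR.claw v w b f
  have h5 := hR.path w v b c d e
  grind

/-- An induced six-cycle is dominating, and so are its three even vertices. -/
lemma hasSmallDom_of_cycle (hR : IsClawPathFree R) (hconn : IsConn R) {a b c d e f : V}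
    (hab : R a b) (hbc : R b c) (hcd : R c d) (hde : R d e) (hef : R e f) (hfa : R f a)
    (hac : ¬ R a c) (had : ¬ R a d) (hae : ¬ R a e) (hbd : ¬ R b d) (hbe : ¬ R b e)
    (hbf : ¬ R b f) (hce : ¬ R c e) (hcf : ¬ R c f) (hdf : ¬ R d f) : HasSmallDom R := by
  have hs := @hR.symm
  have hns : ∀ {x y}, ¬ R x y → ¬ R y x := fun h h' => h (hs h')
  have key := hconn (fun v => R v a ∨ R v b ∨ R v c ∨ R v d ∨ R v e ∨ R v f)
    ⟨a, .inl (hR.refl a)⟩ ?_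
  · refine ⟨a, c, e, fun v => ?_⟩
    have h1 := hR.claw b v a c
    have h2 := hR.claw d v c e
    have h3 := hR.claw f v e a
    have := key v
    grind
  · intro v w hv hvw
    have h1 := hR.claw a v b f
    have h2 := hR.claw b v c a
    have h3 := hR.claw c v d b
    have h4 := hR.claw d v e c
    have h5 := hR.claw e v f d
    have h6 := hR.claw f v a e
    have g1 := fun h h' => hR.dominated_of_neighbour (v := v) (w := w) hbc hcd hde hac had hae
      hbd hbe hbf hce h h' hvw
    have g2 := fun h h' => hR.dominated_of_neighbour (v := v) (w := w) hcd hde hef hbd hbe hbf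
      hce hcf (hns hac) hdf h h' hvw
    have g3 := fun h h' => hR.dominated_of_neighbour (v := v) (w := w) hde hef hfa hce hcf
      (hns hac) hdf (hns had) (hns hbd) (hns hae) h h' hvw
    have g4 := fun h h' => hR.dominated_of_neighbour (v := v) (w := w) hef hfa hab hdf (hns had)
      (hns hbd) (hns hae) (hns hbe) (hns hce) (hns hbf) h h' hvw
    have g5 := fun h h' => hR.dominated_of_neighbour (v := v) (w := w) hfa hab hbc (hns hae)
      (hns hbe) (hns hce) (hns hbf) (hns hcf) (hns hdf) hac h h' hvw
    have g6 := fun h h' => hR.dominated_of_neighbour (v := v) (w := w) hab hbc hcd (hns hbf)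
      (hns hcf) (hns hdf) hac had hae hbd h h' hvw
    grind

end IsClawPathFree

namespace IsClawPathCycleFree

variable {R : V → V → Prop}

/-- Some vertex is at distance at most two from every vertex. -/
lemma exists_radius_two [Finite V] (hR : IsClawPathCycleFree R) (hconn : IsConn R) [Nonempty V] :
    ∃ b, ∀ v, ∃ u, R b u ∧ R u v := by
  have hs := @hR.symm
  obtain ⟨b, hb⟩ := Finite.exists_max fun b => {v | ∃ u, R b u ∧ R u v}.ncard
  refine ⟨b, fun v => ?_⟩
  refine hconn (fun v => ∃ u, R b u ∧ R u v) ⟨b, b, hR.refl b, hR.refl b⟩ ?_ v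
  rintro c z ⟨a, hba, hac⟩ hcz
  by_contra hz
  have hz' : ∀ u, R b u → ¬ R u z := fun u h h' => hz ⟨u, h, h'⟩
  have hbc : ¬ R b c := fun h => hz' c h hcz
  have haz := hz' a hba
  have hbz := hz' b (hR.refl b)
  refine absurd (hb a) (not_le.2 (Set.ncard_lt_ncard ⟨?_, fun h => hz (h ⟨c, hac, hcz⟩)⟩))
  rintro d ⟨a', hba', had'⟩
  by_contra hd
  have hd' : ∀ u, R a u → ¬ R u d := fun u h h' => hd ⟨u, h, h'⟩
  have h1 := hd' a (hR.refl a)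
  have h2 := hd' b (hs hba)
  have h3 := hd' c hac
  have h4 := hz' a' hba'
  have h5 : ¬ R a a' := fun h => hd' a' h had'
  have h6 := hR.claw c a a' z
  have h7 := hR.path d a' b a c z
  have h8 := hR.cycle d a' b a c z
  grind

/-- The vertices outside the closed neighbourhood of `b` all have a common neighbour with `b`, and
`c` labels the connected components of the graph they induce. -/
structure _root_.IsLayering {ι : Type*} (R : V → V → Prop) (b : V) (c : V → ι) : Prop where
  nbr : ∀ z, ∃ a, R b a ∧ R a z
  label_eq : ∀ {y z}, ¬ R b y → ¬ R b z → R y z → c y = c z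
  cross : ∀ (P : V → Prop) {y z}, ¬ R b y → ¬ R b z → c y = c z → P y → ¬ P z →
    ∃ u w, ¬ R b u ∧ ¬ R b w ∧ c u = c y ∧ c w = c y ∧ P u ∧ ¬ P w ∧ R u w
  surj : ∀ i, ∃ z, ¬ R b z ∧ c z = i

lemma adj_of_common (hR : IsClawPathCycleFree R) {b a y z : V} (hba : R b a) (hay : R a y)
    (haz : R a z) (hy : ¬ R b y) (hz : ¬ R b z) : R y z := by
  have := hR.claw a b y z
  have := @hR.symm
  grind

lemma label_eq_of_common {ι : Type*} {c : V → ι} {b : V} (hR : IsClawPathCycleFree R)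
    (hL : IsLayering R b c) {a y z : V} (hba : R b a) (hay : R a y) (haz : R a z) (hy : ¬ R b y)
    (hz : ¬ R b z) : c y = c z :=
  hL.label_eq hy hz (hR.adj_of_common hba hay haz hy hz)

lemma hasSmallDom_of_subsingleton [Finite V] {ι : Type*} {c : V → ι} {b : V}
    [Subsingleton ι] [Nonempty ι] (hR : IsClawPathCycleFree R) (hL : IsLayering R b c) :
    HasSmallDom R := by
  have hs := @hR.symm
  obtain ⟨z₀, hz₀, -⟩ := hL.surj (Classical.arbitrary ι)
  have : Nonempty {z // ¬ R b z} := ⟨⟨z₀, hz₀⟩⟩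
  obtain ⟨⟨e, he⟩, hmax⟩ := Finite.exists_max fun e : {z // ¬ R b z} => {z | ¬ R b z ∧ R e z}.ncard
  by_cases hdom : ∀ z, ¬ R b z → R e z
  · exact ⟨b, e, b, fun v => by have := hdom v; tauto⟩
  push Not at hdom
  obtain ⟨z, hz, hez⟩ := hdom
  obtain ⟨u, w, hu, hw, -, -, heu, hew, huw⟩ :=
    hL.cross (R e) he hz (Subsingleton.elim _ _) (hR.refl e) hez
  obtain ⟨t, ht, hte, htu⟩ : ∃ t, ¬ R b t ∧ R e t ∧ ¬ R u t := by
    by_contra! h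
    exact absurd (hmax ⟨u, hu⟩) (not_le.2 (Set.ncard_lt_ncard
      ⟨fun t ht => ⟨ht.1, h t ht.1 ht.2⟩, fun h' => hew (h' ⟨hw, huw⟩).2⟩))
  obtain ⟨a, hba, haw⟩ := hL.nbr w
  refine ⟨b, a, e, fun y => ?_⟩
  by_contra! hy
  obtain ⟨hby, hay, hey⟩ := hy
  obtain ⟨d, hbd, hdy⟩ := hL.nbr y
  have h1 := hR.claw a b e w
  have h2 := hR.claw d b e y
  have h3 := hR.claw d b t y
  have h4 := hR.claw d b u y
  have hea : ¬ R e a := by grind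
  have hed : ¬ R e d := by grind
  by_cases hta : R t a
  · have h5 := hR.claw t e a y
    have h6 := hR.claw a b u t
    have h7 := hR.claw a b w t
    have h8 := hR.path b a t e u y
    have h9 := hR.claw w u t y
    have h10 := hR.claw w u t d
    have h11 := hR.path e u w a b d
    have h12 := hR.path e u w a d y
    grind
  · by_cases hua : R u a
    · have h5 := hR.claw u e a y
      have h6 := hR.path b a u e t y
      have h7 := hR.path e u a b d y
      have h8 := hR.path t e u a d y
      grind
    · have h5 := hR.claw w u t a
      have h6 := hR.path b a w u e t
      grind

lemma isPacking_of_labels {ι : Type*} {c : V → ι} {b : V} (hR : IsClawPathCycleFree R)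
    (hL : IsLayering R b c) {p : ι → V} (hp : ∀ i, ¬ R b (p i) ∧ c (p i) = i) (i j : ι) (w : V)
    (hi : R (p i) w) (hj : R w (p j)) : i = j := by
  have hs := @hR.symm
  rw [← (hp i).2, ← (hp j).2]
  by_cases hw : R b w
  · exact hR.label_eq_of_common hL hw (hs hi) hj (hp i).1 (hp j).1
  · exact (hL.label_eq (hp i).1 hw hi).trans (hL.label_eq hw (hp j).1 hj)

/-- Adding a vertex without neighbours in the outer layer to a set of representatives. -/
lemma hasTightPacking_option {ι : Type*} [Fintype ι] {c : V → ι} {b : V}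
    (hR : IsClawPathCycleFree R) (hL : IsLayering R b c) {p : ι → V}
    (hp : ∀ i, ¬ R b (p i) ∧ c (p i) = i) {s : ι → V} (hs : ∀ v, R b v ∨ ∃ i, R (s i) v) {u : V}
    (hu : ∀ w z, R b w → ¬ R b z → R u w → ¬ R w z) (hu' : ∀ z, ¬ R b z → ¬ R u z) :
    HasTightPacking R := by
  have hsymm := @hR.symm
  have key : ∀ i w, R u w → ¬ R w (p i) := by
    intro i w huw
    by_cases hbw : R b w
    · exact hu w _ hbw (hp i).1 huw
    · exact absurd huw (hu' w hbw)
  refine .of_families hR.refl (κ := Option ι) (κ' := Option ι) (fun o => o.elim u p)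
    (fun o => o.elim b s) ?_ ?_ le_rfl
  · rintro (_ | i) (_ | j) w h1 h2
    · rfl
    · exact absurd h2 (key j w h1)
    · exact absurd (hsymm h1) (key i w (hsymm h2))
    · rw [hR.isPacking_of_labels hL hp i j w h1 h2]
  · intro v
    rcases hs v with h | ⟨i, h⟩
    exacts [⟨none, h⟩, ⟨some i, h⟩]

lemma hasSmallDom_of_pair {ι : Type*} {b : V} {i j : ι} (hij : ∀ k, k = i ∨ k = j) {s : ι → V}
    (hs : ∀ v, R b v ∨ ∃ i, R (s i) v) : HasSmallDom R := by
  refine ⟨b, s i, s j, fun v => (hs v).imp_right ?_⟩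
  rintro ⟨k, hk⟩
  rcases hij k with rfl | rfl
  exacts [.inl hk, .inr hk]

/-- The case in which every component of the outer layer is completely joined to some neighbour
of `b`. -/
lemma small_or_tight_of_complete [Finite V] {ι : Type*} [Fintype ι] {c : V → ι} {b : V}
    (hR : IsClawPathCycleFree R) (hL : IsLayering R b c) {i₀ j₀ : ι} (hij : i₀ ≠ j₀)
    (hT : ∀ i, ∃ a, R b a ∧ ∀ z, ¬ R b z → c z = i → R a z) :
    HasSmallDom R ∨ HasTightPacking R := by
  classical
  have hs := @hR.symm
  have hne : ∀ i : ι, ∃ j, j ≠ i := fun i => by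
    by_cases h : i₀ = i
    exacts [⟨j₀, fun h' => hij (h.trans h'.symm)⟩, ⟨i₀, h⟩]
  have hcom : ∀ {a y z}, R b a → R a y → R a z → ¬ R b y → ¬ R b z → R y z := hR.adj_of_common
  have hlab : ∀ a y z, R b a → R a y → R a z → ¬ R b y → ¬ R b z → c y = c z :=
    fun _ _ _ => hR.label_eq_of_common hL
  have hlab' := @hL.label_eq
  choose p hp using hL.surj
  choose s hsb hsT using hT
  have hsd : ∀ v, R b v ∨ ∃ i, R (s i) v := fun v => by
    by_cases h : R b v
    exacts [.inl h, .inr ⟨c v, hsT _ v h rfl⟩]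
  by_cases hpair : ∀ k, k = i₀ ∨ k = j₀
  · exact .inl (hasSmallDom_of_pair hpair hsd)
  right
  by_contra hnot
  have hdom : ∀ t : ι → V, ¬ ∀ v, ∃ i, R (t i) v := fun t ht => hnot <|
    .of_families hR.refl p t (hR.isPacking_of_labels hL hp) ht le_rfl
  have hthird : ∀ i j : ι, ∃ k, k ≠ i ∧ k ≠ j := by
    push Not at hpair
    obtain ⟨k, hk⟩ := hpair
    intro i j
    by_cases h1 : k ≠ i ∧ k ≠ j
    · exact ⟨k, h1⟩
    by_cases h2 : i₀ ≠ i ∧ i₀ ≠ j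
    · exact ⟨i₀, h2⟩
    exact ⟨j₀, by grind⟩
  have hmut : ∀ i j v w, i ≠ j → R b v → (∀ z, ¬ R b z → c z = i → R v z) → R b w →
      (∀ z, ¬ R b z → c z = j → R w z) → R v w := by
    intro i j v w hij hbv hv hbw hw
    by_contra hvw
    refine hdom (Function.update (Function.update s i v) j w) fun x => ?_
    by_cases hx : R b x
    · rcases hR.claw b x v w hx hbv hbw with h | h | h
      · exact ⟨i, by rw [Function.update_of_ne hij, Function.update_self]; exact hs h⟩
      · exact ⟨j, by rw [Function.update_self]; exact hs h⟩
      · exact absurd h hvw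
    · refine ⟨c x, ?_⟩
      by_cases hj : c x = j
      · rw [hj, Function.update_self]; exact hw x hx hj
      · rw [Function.update_of_ne hj]
        by_cases hi : c x = i
        · rw [hi, Function.update_self]; exact hv x hx hi
        · rw [Function.update_of_ne hi]; exact hsT _ x hx rfl
  have hss : ∀ i j, i ≠ j → R (s i) (s j) := fun i j h =>
    hmut i j _ _ h (hsb i) (hsT i) (hsb j) (hsT j)
  -- A vertex not dominated by the `s i` has a neighbour in the outer layer.
  have hnbr : ∀ v, R b v → (∀ i, ¬ R (s i) v) → ∃ z, ¬ R b z ∧ R v z := by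
    intro v hbv hv
    by_contra! hvz
    refine hnot (hR.hasTightPacking_option hL hp hsd (u := v) ?_ hvz)
    intro w z hbw hz hvw hwz
    obtain ⟨j, hj⟩ := hne (c z)
    have hnj : ∀ k, k ≠ c z → ¬ R w (s k) := by
      intro k hk h
      have h1 := hR.claw w v z (s k)
      have h2 := hlab (s k) (p k) z
      have h3 := hsT k (p k) (hp k).1 (hp k).2
      have := hp k
      grind
    have hwa : R w (s (c z)) := by
      have h1 := hR.path v w z (s (c z)) (s j) (p j)
      have h2 := hlab w (p j) z
      have h3 := hlab (s j) (p j) z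
      have h4 := hlab (s (c z)) (p j) z
      have h5 := hsT j (p j) (hp j).1 (hp j).2
      have h6 := hsT (c z) z hz rfl
      have h7 := hlab' (hp j).1 hz
      have := hp j
      grind
    refine hnj j hj (hmut (c z) j w (s j) hj.symm hbw ?_ (hsb j) (hsT j))
    intro x hx hxc
    by_contra hwx
    have h1 := hR.claw (s (c z)) x w (s j)
    have h2 := hlab (s j) (p j) x
    have h3 := hsT j (p j) (hp j).1 (hp j).2
    have h4 := hsT (c z) x hx hxc
    have := hp j
    grind
  have hund : ∃ v, R b v ∧ ∀ i, ¬ R (s i) v := by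
    have := hdom s
    push Not at this
    obtain ⟨v, hv⟩ := this
    exact ⟨v, (hsd v).resolve_right fun ⟨i, hi⟩ => hv i hi, hv⟩
  obtain ⟨v₀, hv₀⟩ := hund
  have : Nonempty {v // R b v ∧ ∀ i, ¬ R (s i) v} := ⟨⟨v₀, hv₀⟩⟩
  obtain ⟨⟨v, hbv, hv⟩, hmin⟩ := Finite.exists_min
    fun v : {v // R b v ∧ ∀ i, ¬ R (s i) v} => {z | ¬ R b z ∧ R v z}.ncard
  obtain ⟨z, hz, hvz⟩ := hnbr v hbv hv
  obtain ⟨x, hx, hxc, hvx⟩ : ∃ x, ¬ R b x ∧ c x = c z ∧ ¬ R v x := by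
    by_contra! h
    obtain ⟨j, hj⟩ := hne (c z)
    exact hv j (hs (hmut (c z) j v (s j) hj.symm hbv h (hsb j) (hsT j)))
  have hu := hdom (Function.update s (c z) z)
  push Not at hu
  obtain ⟨u, hu⟩ := hu
  have huz : ¬ R z u := by simpa using hu (c z)
  have huj : ∀ j, j ≠ c z → ¬ R (s j) u := fun j hj => by
    simpa [Function.update_of_ne hj] using hu j
  have hbu : R b u := by
    by_contra h
    by_cases hc : c u = c z
    · have h1 := hsT (c z) u h hc
      have h2 := hsT (c z) z hz rfl
      exact huz (hcom (hsb _) h2 h1 hz h)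
    · exact huj _ hc (hsT _ u h rfl)
  have huv : R u v := by
    obtain ⟨j, hj⟩ := hne (c z)
    have h1 := hR.claw b u v (s j)
    grind
  have hua : ¬ R (s (c z)) u := by
    obtain ⟨j, hj⟩ := hne (c z)
    have h1 := hR.claw (s (c z)) u z (s j)
    have h2 := hlab (s j) (p j) z
    have h3 := hsT j (p j) (hp j).1 (hp j).2
    have h4 := hsT (c z) z hz rfl
    have := hp j
    grind
  have hu' : ∀ j, ¬ R (s j) u := fun j => by
    by_cases h : j = c z
    exacts [h ▸ hua, huj j h]
  obtain ⟨y, hy, huy⟩ := hnbr u hbu hu'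
  by_cases hyc : c y = c z
  · obtain ⟨x', hx', hux', hvx'⟩ : ∃ x', ¬ R b x' ∧ R u x' ∧ ¬ R v x' := by
      by_contra! h
      refine absurd (hmin ⟨u, hbu, hu'⟩) (not_le.2 (Set.ncard_lt_ncard
        ⟨fun t ht => ⟨ht.1, h t ht.1 ht.2⟩, fun h' => huz (hs (h' ⟨hz, hvz⟩).2)⟩))
    obtain ⟨j, hj⟩ := hne (c z)
    have hx'c : c x' = c z := (hlab u x' y hbu hux' huy hx' hy).trans hyc
    have h1 := hR.path (p j) (s j) (s (c z)) x' u v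
    have h2 := hsT j (p j) (hp j).1 (hp j).2
    have h3 := hsT (c z) x' hx' hx'c
    have h4 := hlab (s (c z)) (p j) x'
    have h5 := hlab' (hp j).1 hx'
    have h6 := hlab u (p j) y
    have h7 := hlab v (p j) z
    have h8 := hlab (s j) (p j) x'
    have h9 := hss j (c z) hj
    have := hp j
    grind
  · obtain ⟨j, hj, hj'⟩ := hthird (c z) (c y)
    have h1 := hR.path z v u y (s (c y)) (s j)
    have h2 := hsT (c y) y hy rfl
    have h3 := hss (c y) j hj'.symm
    have h4 := hlab' hz hy
    have h5 := hlab (s (c y)) y z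
    have h6 := hlab v y z
    have h7 := hlab (s j) (p j) z
    have h8 := hlab (s j) (p j) y
    have h9 := hsT j (p j) (hp j).1 (hp j).2
    have := hp j
    grind

/-- The case in which some component of the outer layer is not completely joined to any neighbour
of `b`. -/
lemma small_or_tight_of_not_complete [Finite V] {ι : Type*} [Fintype ι] {c : V → ι} {b : V}
    (hR : IsClawPathCycleFree R) (hL : IsLayering R b c) {i₀ j₀ : ι} (hij : i₀ ≠ j₀)
    (hT : ∀ a, R b a → ∃ z, ¬ R b z ∧ c z = i₀ ∧ ¬ R a z) :
    HasSmallDom R ∨ HasTightPacking R := by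
  classical
  have hs := @hR.symm
  have hcom : ∀ {a y z}, R b a → R a y → R a z → ¬ R b y → ¬ R b z → R y z := hR.adj_of_common
  have hlab : ∀ a y z, R b a → R a y → R a z → ¬ R b y → ¬ R b z → c y = c z :=
    fun _ _ _ => hR.label_eq_of_common hL
  have hlab' := @hL.label_eq
  choose p hp using hL.surj
  have hcross : ∀ a z, R b a → ¬ R b z → c z = i₀ → R a z → ∃ x y, ¬ R b x ∧ ¬ R b y ∧ c x = i₀ ∧
      c y = i₀ ∧ R a x ∧ ¬ R a y ∧ R x y := by
    intro a z ha hz hzc haz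
    obtain ⟨w, hw, hwc, haw⟩ := hT a ha
    have := hL.cross (R a) hz hw (hzc.trans hwc.symm) haz haw
    rwa [hzc] at this
  have hmut : ∀ a z a' z', R b a → ¬ R b z → c z = i₀ → R a z → R b a' → ¬ R b z' → c z' ≠ i₀ →
      R a' z' → R a a' := by
    intro a z a' z' ha hz hzc haz ha' hz' hzc' haz'
    obtain ⟨x, y, hx, hy, hxc, hyc, hax, hay, hxy⟩ := hcross a z ha hz hzc haz
    have h1 := hR.path y x a b a' z'
    have h2 := hlab a x z'
    have h3 := hlab a' x z'
    have h4 := hlab a' y z'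
    have h5 := hlab' hx hz'
    have h6 := hlab' hy hz'
    grind
  obtain ⟨a₀, ha₀, haz₀⟩ := hL.nbr (p i₀)
  have hT' : ∀ j, j ≠ i₀ → ∃ a, R b a ∧ ∀ z, ¬ R b z → c z = j → R a z := by
    intro j hj
    by_contra! hj'
    obtain ⟨a, ha, haz⟩ := hL.nbr (p j)
    obtain ⟨w, hw, hwc, haw⟩ := hj' a ha
    obtain ⟨x', y', hx', hy', hxc', hyc', hax', hay', hxy'⟩ :=
      hL.cross (R a) (hp j).1 hw ((hp j).2.trans hwc.symm) haz haw
    obtain ⟨x, y, hx, hy, hxc, hyc, hax, hay, hxy⟩ :=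
      hcross a₀ _ ha₀ (hp i₀).1 (hp i₀).2 haz₀
    rw [(hp j).2] at hxc' hyc'
    have h0 := hmut a₀ x a x' ha₀ hx hxc hax ha hx' (hxc'.trans_ne hj) hax'
    have h1 := hR.path y x a₀ a x' y'
    have h2 := hlab a₀ x x'
    have h3 := hlab a₀ x y'
    have h4 := hlab a x x'
    have h5 := hlab a y x'
    have h6 := hlab' hx hx'
    have h7 := hlab' hx hy'
    have h8 := hlab' hy hx'
    have h9 := hlab' hy hy'
    grind
  have : Nonempty V := ⟨b⟩
  choose! t htb htT using hT'
  have hj₀ : j₀ ≠ i₀ := hij.symm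
  -- A vertex of the special component with a largest neighbourhood dominates that component.
  have : Nonempty {y // ¬ R b y ∧ c y = i₀} := ⟨⟨p i₀, hp i₀⟩⟩
  obtain ⟨⟨y, hy, hyc⟩, hmax⟩ := Finite.exists_max
    fun y : {y // ¬ R b y ∧ c y = i₀} => {a | R b a ∧ R a y}.ncard
  have hjp := htT j₀ hj₀ (p j₀) (hp j₀).1 (hp j₀).2
  have hycdom : ∀ z, ¬ R b z → c z = i₀ → R y z := by
    intro z hz hzc
    by_contra hyz
    obtain ⟨u, w, hu, hw, huc, hwc, hyu, hyw, huw⟩ :=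
      hL.cross (R y) hy hz (hyc.trans hzc.symm) (hR.refl y) hyz
    rw [hyc] at huc hwc
    have hout : ∀ x, ¬ R b x → c x = i₀ → ¬ R (t j₀) x ∧ ¬ R x (p j₀) := by
      intro x hx hxc
      have h1 := hlab (t j₀) (p j₀) x
      have h2 := hlab' hx (hp j₀).1
      have := hp j₀
      have := htb j₀ hj₀
      grind
    have hsub : ∀ y w, ¬ R b y → c y = i₀ → ¬ R b w → c w = i₀ → R y u → R u w → ¬ R y w →
        ∀ a, R b a → R a y → R a u := by
      intro y w hy hyc hw hwc hyu huw hyw a ha hay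
      by_contra hau
      have h1 := hR.path w u y a (t j₀) (p j₀)
      have h2 := hcom ha hay (z := w)
      have h3 := hmut a y (t j₀) (p j₀) ha hy hyc hay (htb j₀ hj₀) (hp j₀).1
        ((hp j₀).2.trans_ne hj₀) hjp
      have h4 := hout y hy hyc
      have h5 := hout u hu huc
      have h6 := hout w hw hwc
      have h7 := hlab a y (p j₀)
      have := hp j₀
      grind
    obtain ⟨a, ha, haw⟩ := hL.nbr w
    refine absurd (hmax ⟨u, hu, huc⟩) (not_le.2 (Set.ncard_lt_ncard
      ⟨fun a ha => ⟨ha.1, hsub y w hy hyc hw hwc hyu huw hyw a ha.1 ha.2⟩, fun h => ?_⟩))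
    have hau := hsub w y hw hwc hy hyc (hs huw) (hs hyu) (fun h => hyw (hs h)) a ha haw
    exact hyw (hcom ha (h ⟨ha, hau⟩).2 haw hy hw)
  set s : ι → V := Function.update t i₀ y with hsdef
  have hsi : s i₀ = y := by simp [hsdef]
  have hsj : ∀ j, j ≠ i₀ → s j = t j := fun j hj => by simp [hsdef, hj]
  have hsT : ∀ z, ¬ R b z → R (s (c z)) z := by
    intro z hz
    by_cases hc : c z = i₀
    · rw [hc, hsi]; exact hycdom z hz hc
    · rw [hsj _ hc]; exact htT _ hc z hz rfl
  have hsd : ∀ v, R b v ∨ ∃ i, R (s i) v := fun v => by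
    by_cases h : R b v
    exacts [.inl h, .inr ⟨c v, hsT v h⟩]
  by_cases hpair : ∀ k, k = i₀ ∨ k = j₀
  · exact .inl (hasSmallDom_of_pair hpair hsd)
  right
  by_cases hdom : ∀ v, ∃ i, R (s i) v
  · exact .of_families hR.refl p s (hR.isPacking_of_labels hL hp) hdom le_rfl
  push Not at hdom
  obtain ⟨u, hu⟩ := hdom
  have hbu : R b u := (hsd u).resolve_right fun ⟨i, hi⟩ => hu i hi
  have huy : ¬ R y u := by simpa [hsi] using hu i₀
  have hut : ∀ j, j ≠ i₀ → ¬ R (t j) u := fun j hj => by simpa [hsj j hj] using hu j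
  obtain ⟨a, ha, hay⟩ := hL.nbr y
  have hi : ∀ z, ¬ R b z → c z = i₀ → ¬ R u z := fun z hz hzc huz =>
    hut j₀ hj₀ (hs (hmut u z (t j₀) (p j₀) hbu hz hzc huz (htb j₀ hj₀) (hp j₀).1
      ((hp j₀).2.trans_ne hj₀) hjp))
  have hu' : ∀ z, ¬ R b z → ¬ R u z := by
    intro z hz huz
    have hzc : c z ≠ i₀ := fun h => hi z hz h huz
    have h1 := hmut a y u z ha hy hyc hay hbu hz hzc huz
    have h2 := hmut a y (t (c z)) z ha hy hyc hay (htb _ hzc) hz hzc (htT _ hzc z hz rfl)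
    rcases hR.claw a u (t (c z)) y h1 h2 hay with h | h | h
    · exact hut _ hzc (hs h)
    · exact huy (hs h)
    · exact hzc ((hlab _ y z (htb _ hzc) h (htT _ hzc z hz rfl) hy hz).symm.trans hyc)
  have huw : ∀ w z, R b w → ¬ R b z → c z = i₀ → R u w → ¬ R w z := by
    intro w z hbw hz hzc huw hwz
    have h1 := hmut w z (t j₀) (p j₀) hbw hz hzc hwz (htb j₀ hj₀) (hp j₀).1
      ((hp j₀).2.trans_ne hj₀) hjp
    rcases hR.claw w u z (t j₀) (hs huw) hwz h1 with h | h | h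
    · exact hu' z hz h
    · exact hut j₀ hj₀ (hs h)
    · have := hlab _ z (p j₀) (htb j₀ hj₀) (hs h) hjp hz (hp j₀).1
      exact hj₀ ((hp j₀).2.symm.trans (this.symm.trans hzc))
  refine hR.hasTightPacking_option hL hp hsd (u := u) ?_ hu'
  intro w z hbw hz huw' hwz
  by_cases hzc : c z = i₀
  · exact huw w z hbw hz hzc huw' hwz
  · have h1 := hmut a y w z ha hy hyc hay hbw hz hzc hwz
    rcases hR.claw w a u z (hs h1) (hs huw') hwz with h | h | h
    · exact huw a y ha hy hyc (hs h) hay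
    · exact hzc ((hlab a y z ha hay h hy hz).symm.trans hyc)
    · exact hu' z hz h

/-- The labelling of the outer layer by its connected components. -/
lemma exists_isLayering {V : Type u} {R : V → V → Prop} (hR : IsClawPathCycleFree R)
    {b : V} (hb : ∀ z, ∃ a, R b a ∧ R a z)
    {z₀ : V} (hz₀ : ¬ R b z₀) : ∃ (ι : Type u) (c : V → ι), Nonempty ι ∧ IsLayering R b c ∧
      (Finite V → Finite ι) := by
  classical
  let E : V → V → Prop := fun x y => ¬ R b x ∧ ¬ R b y ∧ R x y
  let S : Setoid V := Relation.EqvGen.setoid E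
  let ι := {q : Quotient S // ∃ z, ¬ R b z ∧ ⟦z⟧ = q}
  let c : V → ι := fun v => if h : R b v then ⟨⟦z₀⟧, z₀, hz₀, rfl⟩ else ⟨⟦v⟧, v, h, rfl⟩
  have hc : ∀ v, ¬ R b v → (c v).1 = ⟦v⟧ := fun v hv => by simp [c, hv]
  have hcE : ∀ {y z}, ¬ R b y → ¬ R b z → R y z → c y = c z := fun {y z} hy hz hyz => by
    apply Subtype.ext
    rw [hc y hy, hc z hz]
    exact Quotient.sound (.rel _ _ ⟨hy, hz, hyz⟩)
  refine ⟨ι, c, ⟨c z₀⟩, ⟨hb, hcE, ?_, ?_⟩, fun _ => inferInstance⟩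
  · intro P y z hy hz hyz hPy hPz
    by_contra! hcl
    have key : ∀ u w, Relation.EqvGen E u w →
        ((¬ R b u ∧ c u = c y ∧ P u) ↔ (¬ R b w ∧ c w = c y ∧ P w)) := by
      intro u w huw
      induction huw with
      | rel u w h =>
        have h1 := hcE h.1 h.2.1 h.2.2
        have h2 := hcl u w h.1 h.2.1
        have h3 := hcl w u h.2.1 h.1
        have h4 := hR.symm h.2.2
        have h5 := h.2.2
        have h6 := h.1
        have h7 := h.2.1
        grind
      | refl => rfl
      | symm _ _ _ ih => exact ih.symm
      | trans _ _ _ _ _ ih1 ih2 => exact ih1.trans ih2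
    have h := congrArg Subtype.val hyz
    rw [hc y hy, hc z hz] at h
    exact hPz ((key y z (Quotient.exact h)).1 ⟨hy, rfl, hPy⟩).2.2
  · rintro ⟨q, z, hz, rfl⟩
    exact ⟨z, hz, Subtype.ext (hc z hz)⟩

lemma small_or_tight [Finite V] [Nonempty V] (hR : IsClawPathCycleFree R) (hconn : IsConn R) :
    HasSmallDom R ∨ HasTightPacking R := by
  classical
  obtain ⟨b, hb⟩ := hR.exists_radius_two hconn
  by_cases hz : ∀ z, R b z
  · exact .inl ⟨b, b, b, fun v => .inl (hz v)⟩
  push Not at hz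
  obtain ⟨z₀, hz₀⟩ := hz
  obtain ⟨ι, c, hι, hL, hfin⟩ := hR.exists_isLayering hb hz₀
  have := hfin ‹_›
  have := Fintype.ofFinite ι
  cases subsingleton_or_nontrivial ι with
  | inl h => exact .inl (hR.hasSmallDom_of_subsingleton hL)
  | inr h =>
    by_cases hT : ∀ i, ∃ a, R b a ∧ ∀ z, ¬ R b z → c z = i → R a z
    · obtain ⟨i, j, hij⟩ := exists_pair_ne ι
      exact hR.small_or_tight_of_complete hL hij hT
    · push Not at hT
      obtain ⟨i, hi⟩ := hT
      obtain ⟨j, hj⟩ := exists_ne i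
      exact hR.small_or_tight_of_not_complete hL hj.symm hi

end IsClawPathCycleFree

end Structure

lemma SimpleGraph.Connected.isConn_closedAdj {V : Type*} {G : SimpleGraph V} (h : G.Connected) :
    IsConn (ClosedAdj G) := by
  rintro P ⟨u, hu⟩ hP v
  obtain ⟨p⟩ := h.preconnected u v
  induction p with
  | nil => exact hu
  | cons hadj _ ih => exact ih (hP _ _ hu (.inr hadj))

lemma IsFree.isClawPathFree {V : Type*} {G : SimpleGraph V}
    (hclaw : IsFree G (completeBipartiteGraph (Fin 1) (Fin 3)))
    (hP6 : IsFree G (pathGraph 6)) : IsClawPathFree (ClosedAdj G) where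
  refl _ := .rfl
  symm := ClosedAdj.symm
  claw _ _ _ _ := hclaw.claw
  path a b c d e f hab hbc hcd hde hef := by
    by_contra! h
    obtain ⟨h1, h2, h3, h4, h5, h6, h7, h8, h9, h10⟩ := h
    exact hP6.path_six hab hbc hcd hde hef h1 h2 h3 h4 h5 h6 h7 h8 h9 h10

lemma IsClawPathFree.small_or_tight {V : Type*} [Finite V] [Nonempty V] {R : V → V → Prop}
    (hR : IsClawPathFree R) (hconn : IsConn R) : HasSmallDom R ∨ HasTightPacking R := by
  by_cases hsmall : HasSmallDom R
  · exact .inl hsmall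
  · refine IsClawPathCycleFree.small_or_tight ⟨hR, ?_⟩ hconn
    intro a b c d e f hab hbc hcd hde hef hfa
    by_contra! h
    obtain ⟨h1, h2, h3, h4, h5, h6, h7, h8, h9⟩ := h
    exact hsmall (hR.hasSmallDom_of_cycle hconn hab hbc hcd hde hef hfa h1 h2 h3 h4 h5 h6 h7 h8 h9)

theorem stmt_7 {V W : Type*} [Fintype V] [Fintype W] (G : SimpleGraph V) (hconn : G.Connected)
    (hclaw : IsFree G (completeBipartiteGraph (Fin 1) (Fin 3)))
    (hP6 : IsFree G (pathGraph 6)) (H : SimpleGraph W) :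
    domNum G * domNum H ≤ domNum (G □ H) := by
  classical
  have := hconn.nonempty
  rcases (hclaw.isClawPathFree hP6).small_or_tight hconn.isConn_closedAdj with
    ⟨a, b, c, h⟩ | ⟨S, T, hS, hT, hcard⟩
  · refine hclaw.mul_domNum_le_of_domNum_le_three
      ((domNum_le (S := {a, b, c}) (isDomSet_iff.2 fun v => ?_)).trans Finset.card_le_three) H
    simpa using h v
  · exact (Nat.mul_le_mul_right _ ((domNum_le (isDomSet_iff.2 hT)).trans hcard)).trans
      (IsPacking.card_mul_domNum_le hS H)
end

section
/- Let G be a finite connected simple graph that is K_4-free and P_5-free (contains no induced subgraph isomorphic to the complete graph K_4 nor to the path on 5 vertices). Then γ(G) ≤ 3. -/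
open SimpleGraph Finset

/-- `X` induces a connected subgraph: a nonempty part of `X` that no edge leaves inside `X`
is all of `X`. -/
def InducesConn {V : Type*} (G : SimpleGraph V) (X : Finset V) : Prop :=
  ∀ D ⊆ X, D.Nonempty → (∀ u ∈ D, ∀ v ∈ X, G.Adj u v → v ∈ D) → D = X

/-- `X` is a connected dominating set of minimum size. -/
structure IsMinConnDomSet {V : Type*} (G : SimpleGraph V) (X : Finset V) : Prop where
  dom : IsDomSet G X
  conn : InducesConn G X
  le_card : ∀ Y : Finset V, IsDomSet G Y → InducesConn G Y → X.card ≤ Y.card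

/-- `p` is a neighbour of `a` outside `X` with no other neighbour in `X`. -/
structure IsPrivateNbr {V : Type*} (G : SimpleGraph V) (X : Finset V) (a p : V) : Prop where
  notMem : p ∉ X
  adj : G.Adj p a
  not_adj : ∀ x ∈ X, x ≠ a → ¬ G.Adj p x

theorem IsFree.not_path_five {V : Type*} {G : SimpleGraph V} (hP5 : IsFree G (pathGraph 5))
    {p q r s t : V} (hpq : G.Adj p q) (hqr : G.Adj q r) (hrs : G.Adj r s) (hst : G.Adj s t)
    (hpr : ¬ G.Adj p r) (hps : ¬ G.Adj p s) (hpt : ¬ G.Adj p t)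
    (hqs : ¬ G.Adj q s) (hqt : ¬ G.Adj q t) (hrt : ¬ G.Adj r t) : False := by
  have hadj : ∀ i j : Fin 5, G.Adj (![p, q, r, s, t] i) (![p, q, r, s, t] j) ↔
      (pathGraph 5).Adj i j := by
    intro i j
    rw [pathGraph_adj]
    fin_cases i <;> fin_cases j <;> simp <;> grind [G.adj_comm]
  refine hP5 ⟨⟨⟨![p, q, r, s, t], ?_⟩, hadj _ _⟩⟩
  intro i j hij
  have hnbr : ∀ k, (pathGraph 5).Adj i k ↔ (pathGraph 5).Adj j k := by
    intro k
    rw [← hadj, ← hadj, hij]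
  simp only [pathGraph_adj] at hnbr
  clear hij
  revert hnbr i j
  clear * -
  decide

theorem InducesConn.univ {V : Type*} [Fintype V] {G : SimpleGraph V} (h : G.Connected) :
    InducesConn G univ := by
  intro D _ ⟨u, hu⟩ hD
  refine Finset.eq_univ_of_forall fun v => ?_
  obtain ⟨w⟩ := h.preconnected u v
  induction w with
  | nil => exact hu
  | cons hadj _ ih => exact ih (hD _ hu _ (mem_univ _) hadj)

theorem InducesConn.insert {V : Type*} [DecidableEq V] {G : SimpleGraph V} {X : Finset V}
    (h : InducesConn G X) {a p : V} (ha : a ∈ X) (hp : G.Adj p a) :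
    InducesConn G (insert p X) := by
  intro D hDX hne hD
  have haD : a ∈ D := by
    by_cases hpD : p ∈ D
    · exact hD p hpD a (mem_insert_of_mem ha) hp
    · have : D = X := h D (by grind) hne fun u hu v hv => hD u hu v (mem_insert_of_mem hv)
      exact this ▸ ha
  have hpD : p ∈ D := hD a haD p (mem_insert_self _ _) hp.symm
  have hDX' : D ∩ X = X := h _ inter_subset_right ⟨a, by grind⟩ (by grind)
  grind

/-- If `a` is a cut vertex of `X`, then some neighbour `f` of `a` in `X` is separated by `a`
from a given `b`. -/
theorem InducesConn.exists_separated {V : Type*} [DecidableEq V] {G : SimpleGraph V}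
    {X : Finset V} (h : InducesConn G X) {a b : V} (hb : b ∈ X) (hab : b ≠ a)
    (hcut : ¬ InducesConn G (X.erase a)) :
    ∃ D ⊆ X.erase a, b ∈ D ∧ (∀ u ∈ D, ∀ v ∈ X.erase a, G.Adj u v → v ∈ D) ∧
      ∃ f ∈ X.erase a, f ∉ D ∧ G.Adj f a := by
  obtain ⟨D, hDX, hbD, hD, hne⟩ : ∃ D ⊆ X.erase a, b ∈ D ∧
      (∀ u ∈ D, ∀ v ∈ X.erase a, G.Adj u v → v ∈ D) ∧ D ≠ X.erase a := by
    unfold InducesConn at hcut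
    push Not at hcut
    obtain ⟨D, hDX, hDne, hD, hne⟩ := hcut
    by_cases hbD : b ∈ D
    · exact ⟨D, hDX, hbD, hD, hne⟩
    · refine ⟨X.erase a \ D, sdiff_subset, by grind, ?_, ?_⟩
      · intro u hu v hv huv
        have := fun hvD => hD v hvD u (by grind) huv.symm
        grind
      · obtain ⟨x, hx⟩ := hDne
        intro heq
        have : x ∈ X.erase a \ D := heq.symm.subset (hDX hx)
        grind
  refine ⟨D, hDX, hbD, hD, ?_⟩
  by_contra! hf
  have hEne : (X.erase a \ D).Nonempty := by
    rw [sdiff_nonempty]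
    exact fun hsub => hne (hDX.antisymm hsub)
  have hE := h (X.erase a \ D) (by grind) hEne (by
    intro u hu v hv huv
    have h1 := hf u (by grind) (by grind)
    have h2 := fun hvD => hD v hvD u (by grind) huv.symm
    grind)
  have : b ∈ X.erase a \ D := hE.symm.subset hb
  grind

theorem adj_of_isPrivateNbr {V : Type*} {G : SimpleGraph V} {X : Finset V}
    (hP5 : IsFree G (pathGraph 5)) {a b c p q : V}
    (ha : a ∈ X) (hb : b ∈ X) (hc : c ∈ X) (hab : G.Adj a b) (hbc : G.Adj b c)
    (hac : ¬ G.Adj a c) (hne : a ≠ c) (hp : IsPrivateNbr G X a p) (hq : IsPrivateNbr G X c q) :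
    G.Adj p q := by
  by_contra hpq
  exact hP5.not_path_five hp.adj hab hbc hq.adj.symm (hp.not_adj b hb hab.ne')
    (hp.not_adj c hc hne.symm) hpq hac (fun h => hq.not_adj a ha hne h.symm)
    (fun h => hq.not_adj b hb hbc.ne h.symm)

namespace IsMinConnDomSet

variable {V : Type*} [DecidableEq V] {G : SimpleGraph V} {X : Finset V}

theorem exists_isPrivateNbr (hX : IsMinConnDomSet G X) {a b : V} (ha : a ∈ X) (hb : b ∈ X)
    (hab : G.Adj a b) (hconn : InducesConn G (X.erase a)) : ∃ p, IsPrivateNbr G X a p := by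
  have hndom : ¬ IsDomSet G (X.erase a) := by
    intro hdom
    have := hX.le_card _ hdom hconn
    have := card_erase_lt_of_mem ha
    omega
  unfold IsDomSet at hndom
  push Not at hndom
  obtain ⟨p, hpX, hp⟩ := hndom
  have hpa : p ≠ a := fun h => hp b (mem_erase.2 ⟨hab.ne', hb⟩) (h ▸ hab.symm)
  have hpX' : p ∉ X := fun h => hpX (mem_erase.2 ⟨hpa, h⟩)
  have hpn : ∀ x ∈ X, x ≠ a → ¬ G.Adj p x := fun x hx hxa h =>
    hp x (mem_erase.2 ⟨hxa, hx⟩) h.symm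
  refine ⟨p, hpX', ?_, hpn⟩
  obtain h | ⟨u, hu, hup⟩ := hX.dom p
  · exact absurd h hpX'
  · by_cases hua : u = a
    · exact hua ▸ hup.symm
    · exact absurd hup.symm (hpn u hu hua)

/-- The end of an induced path on three vertices is not a cut vertex. -/
theorem inducesConn_erase (hX : IsMinConnDomSet G X) (hP5 : IsFree G (pathGraph 5)) {a b c : V}
    (ha : a ∈ X) (hb : b ∈ X) (hc : c ∈ X) (hab : G.Adj a b) (hbc : G.Adj b c)
    (hac : ¬ G.Adj a c) (hne : a ≠ c) : InducesConn G (X.erase a) := by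
  by_contra hcut
  obtain ⟨D, hDX, hbD, hD, d, hdX, hdD, hda⟩ := hX.conn.exists_separated hb hab.ne' hcut
  have hcD : c ∈ D := hD b hbD c (mem_erase.2 ⟨hne.symm, hc⟩) hbc
  have hdb : ¬ G.Adj d b := fun h => hdD (hD b hbD d hdX h.symm)
  have hdc : ¬ G.Adj d c := fun h => hdD (hD c hcD d hdX h.symm)
  have hbd : b ≠ d := fun h => hdD (h ▸ hbD)
  have hcd : c ≠ d := fun h => hdD (h ▸ hcD)
  replace hdX := mem_of_mem_erase hdX
  by_cases hconn : InducesConn G (X.erase d)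
  · obtain ⟨p, hp⟩ := hX.exists_isPrivateNbr hdX ha hda hconn
    exact hP5.not_path_five hp.adj hda hab hbc (hp.not_adj a ha hda.ne')
      (hp.not_adj b hb hbd) (hp.not_adj c hc hcd) hdb hdc hac
  · obtain ⟨E, hEX, haE, hE, f, hfX, hfE, hfd⟩ :=
      hX.conn.exists_separated ha hda.ne' hconn
    have hbE : b ∈ E := hE a haE b (mem_erase.2 ⟨hbd, hb⟩) hab
    have hcE : c ∈ E := hE b hbE c (mem_erase.2 ⟨hcd, hc⟩) hbc
    have hf : ∀ x ∈ E, ¬ G.Adj f x := fun x hx h => hfE (hE x hx f hfX h.symm)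
    exact hP5.not_path_five hfd hda hab hbc (hf a haE) (hf b hbE) (hf c hcE) hdb hdc hac

theorem exists_isPrivateNbr_of_path (hX : IsMinConnDomSet G X) (hP5 : IsFree G (pathGraph 5))
    {a b c : V} (ha : a ∈ X) (hb : b ∈ X) (hc : c ∈ X) (hab : G.Adj a b) (hbc : G.Adj b c)
    (hac : ¬ G.Adj a c) (hne : a ≠ c) : ∃ p, IsPrivateNbr G X a p :=
  hX.exists_isPrivateNbr ha hb hab (hX.inducesConn_erase hP5 ha hb hc hab hbc hac hne)

/-- A vertex of `X` adjacent to the middle or the far end of an induced path on three vertices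
is adjacent to the near end. -/
theorem adj_end (hX : IsMinConnDomSet G X) (hP5 : IsFree G (pathGraph 5)) {a b c e : V}
    (ha : a ∈ X) (hb : b ∈ X) (hc : c ∈ X) (hab : G.Adj a b) (hbc : G.Adj b c)
    (hac : ¬ G.Adj a c) (hne : a ≠ c) (he : e ∈ X) (hea : e ≠ a) (hec : e ≠ c)
    (h : G.Adj e b ∨ G.Adj e c) : G.Adj e a := by
  obtain ⟨p, hp⟩ := hX.exists_isPrivateNbr_of_path hP5 ha hb hc hab hbc hac hne
  obtain ⟨q, hq⟩ := hX.exists_isPrivateNbr_of_path hP5 hc hb ha hbc.symm hab.symm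
    (fun h => hac h.symm) hne.symm
  have hpq := adj_of_isPrivateNbr hP5 ha hb hc hab hbc hac hne hp hq
  have hep : ¬ G.Adj e p := fun h => hp.not_adj e he hea h.symm
  have heq : ¬ G.Adj e q := fun h => hq.not_adj e he hec h.symm
  have haq : ¬ G.Adj a q := fun h => hq.not_adj a ha hne h.symm
  have hcp : ¬ G.Adj c p := fun h => hp.not_adj c hc hne.symm h.symm
  by_contra hea'
  by_cases hec' : G.Adj e c
  · exact hP5.not_path_five hec' hq.adj.symm hpq.symm hp.adj heq hep hea' hcp
      (fun h => hac h.symm) (fun h => haq h.symm)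
  · exact hP5.not_path_five (h.resolve_right hec') hab.symm hp.adj.symm hpq hea' hep heq
      (fun h => hp.not_adj b hb hab.ne' h.symm) (fun h => hq.not_adj b hb hbc.ne h.symm) haq

/-- Exchanging one end of an induced path on three vertices for a private neighbour of the other
end preserves minimality. -/
theorem exchange (hX : IsMinConnDomSet G X) (hP5 : IsFree G (pathGraph 5)) {a b c p : V}
    (ha : a ∈ X) (hb : b ∈ X) (hc : c ∈ X) (hab : G.Adj a b) (hbc : G.Adj b c)
    (hac : ¬ G.Adj a c) (hne : a ≠ c) (hp : IsPrivateNbr G X a p) :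
    IsMinConnDomSet G (insert p (X.erase c)) := by
  refine ⟨?_, ?_, ?_⟩
  · intro v
    by_cases hv : ∃ u ∈ X.erase c, G.Adj u v
    · obtain ⟨u, hu, huv⟩ := hv
      exact .inr ⟨u, mem_insert_of_mem hu, huv⟩
    · push Not at hv
      by_cases hvc : v = c
      · exact absurd (hvc ▸ hbc) (hv b (mem_erase.2 ⟨hbc.ne, hb⟩))
      by_cases hvX : v ∈ X
      · exact .inl (mem_insert_of_mem (mem_erase.2 ⟨hvc, hvX⟩))
      · obtain ⟨u, hu, huv⟩ := (hX.dom v).resolve_left hvX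
        have huc : u = c := by
          by_contra huc
          exact hv u (mem_erase.2 ⟨huc, hu⟩) huv
        have hvpriv : IsPrivateNbr G X c v :=
          ⟨hvX, huc ▸ huv.symm, fun x hx hxc h => hv x (mem_erase.2 ⟨hxc, hx⟩) h.symm⟩
        exact .inr ⟨p, mem_insert_self _ _,
          adj_of_isPrivateNbr hP5 ha hb hc hab hbc hac hne hp hvpriv⟩
  · exact (hX.inducesConn_erase hP5 hc hb ha hbc.symm hab.symm (fun h => hac h.symm)
      hne.symm).insert (mem_erase.2 ⟨hne, ha⟩) hp.adj
  · intro Y hY hY'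
    refine le_trans ?_ (hX.le_card Y hY hY')
    have := card_insert_le p (X.erase c)
    have := card_erase_add_one hc
    omega

/-- A minimum connected dominating set containing an induced path on three vertices is that
path. -/
theorem eq_of_path (hX : IsMinConnDomSet G X) (hP5 : IsFree G (pathGraph 5)) {a b c : V}
    (ha : a ∈ X) (hb : b ∈ X) (hc : c ∈ X) (hab : G.Adj a b) (hbc : G.Adj b c)
    (hac : ¬ G.Adj a c) (hne : a ≠ c) : {a, b, c} = X := by
  refine hX.conn _ (by grind) ⟨a, by simp⟩ ?_
  intro u hu e he hue
  by_contra heD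
  simp only [mem_insert, mem_singleton, not_or] at hu heD
  obtain ⟨hea, heb, hec⟩ := heD
  have hadj : G.Adj e a := by
    rcases hu with rfl | rfl | rfl
    · exact hue.symm
    · exact hX.adj_end hP5 ha hb hc hab hbc hac hne he hea hec (.inl hue.symm)
    · exact hX.adj_end hP5 ha hb hc hab hbc hac hne he hea hec (.inr hue.symm)
  obtain ⟨p, hp⟩ := hX.exists_isPrivateNbr_of_path hP5 ha hb hc hab hbc hac hne
  have hpe : e ≠ p := fun h => hp.notMem (h ▸ he)
  have hpb : p ≠ b := fun h => hp.notMem (h ▸ hb)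
  have hY := hX.exchange hP5 ha hb hc hab hbc hac hne hp
  have := hY.adj_end hP5 (mem_insert_self _ _) (mem_insert_of_mem (mem_erase.2 ⟨hne, ha⟩))
    (mem_insert_of_mem (mem_erase.2 ⟨hbc.ne, hb⟩)) hp.adj hab (hp.not_adj b hb hab.ne') hpb
    (mem_insert_of_mem (mem_erase.2 ⟨hec, he⟩)) hpe heb (.inl hadj)
  exact hp.not_adj e he hea this.symm

/-- In a connected `P₅`-free graph, a minimum connected dominating set is a clique or has at most
three vertices. -/
theorem isClique_or_card_le (hX : IsMinConnDomSet G X) (hP5 : IsFree G (pathGraph 5)) :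
    G.IsClique X ∨ X.card ≤ 3 := by
  classical
  by_cases h : ∃ a ∈ X, ∃ b ∈ X, ∃ c ∈ X, G.Adj a b ∧ G.Adj b c ∧ ¬ G.Adj a c ∧ a ≠ c
  · obtain ⟨a, ha, b, hb, c, hc, hab, hbc, hac, hne⟩ := h
    rw [← hX.eq_of_path hP5 ha hb hc hab hbc hac hne]
    exact .inr card_le_three
  · push Not at h
    refine .inl fun u hu v hv huv => ?_
    have hD := hX.conn (X.filter fun x => x = u ∨ G.Adj u x) (filter_subset _ _)
      ⟨u, mem_filter.2 ⟨hu, .inl rfl⟩⟩ (by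
        intro x hx y hy hxy
        simp only [mem_filter] at hx ⊢
        refine ⟨hy, ?_⟩
        rcases hx.2 with rfl | hux
        · exact .inr hxy
        · by_contra! hn
          exact hn.1 (h u hu x hx.1 y hy hux hxy hn.2).symm)
    have hv' : v ∈ X.filter fun x => x = u ∨ G.Adj u x := hD.symm.subset hv
    exact ((mem_filter.1 hv').2).resolve_left huv.symm

end IsMinConnDomSet

theorem exists_isMinConnDomSet {V : Type*} [Fintype V] {G : SimpleGraph V} (h : G.Connected) :
    ∃ X, IsMinConnDomSet G X := by
  classical
  obtain ⟨X, hX, hmin⟩ := exists_min_image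
    (univ.filter fun X : Finset V => IsDomSet G X ∧ InducesConn G X) card
    ⟨univ, by simpa using ⟨fun v => .inl (mem_univ v), InducesConn.univ h⟩⟩
  simp only [mem_filter, mem_univ, true_and] at hX hmin
  exact ⟨X, hX.1, hX.2, fun Y h1 h2 => hmin Y ⟨h1, h2⟩⟩

theorem stmt_11 {V : Type*} [Fintype V] (G : SimpleGraph V) (hconn : G.Connected)
    (hK4 : IsFree G (⊤ : SimpleGraph (Fin 4)))
    (hP5 : IsFree G (pathGraph 5)) :
    domNum G ≤ 3 := by
  classical
  obtain ⟨X, hX⟩ := exists_isMinConnDomSet hconn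
  have hcard : X.card ≤ 3 := by
    refine (hX.isClique_or_card_le hP5).elim (fun hcl => ?_) id
    by_contra! h
    obtain ⟨Y, hYX, hY⟩ := exists_subset_card_eq (show 4 ≤ X.card from h)
    refine hK4 ⟨topEmbeddingOfNotCliqueFree fun hfree : G.CliqueFree 4 => ?_⟩
    exact hfree Y ⟨hcl.subset (coe_subset.2 hYX), hY⟩
  have hle : domNum G ≤ X.card := Nat.sInf_le ⟨X, rfl, hX.dom⟩
  exact hle.trans hcard
end
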